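/- arXiv:2201.01023 — 2 statements merged into one kernel-verified Lean document; each statement's English description precedes it below -/
import Mathlib

section
/- Let (R,m,k) be a commutative Noetherian local ring and let M and N be finitely generated R-modules with N faithful (i.e., the annihilator of N in R is zero). If t ≥ 0 is an integer such that Tor_t^R(M, mN) = 0, then the projective dimension of M is at most t. -/
open CategoryTheory

universe u

/-- The colon submodule `(N :_X I) = {x ∈ X : I • x ⊆ N}`. -/
def Submodule.colonBy {R X : Type u} [CommRing R] [AddCommGroup X] [Module R X]
    (N : Submodule R X) (I : Ideal R) : Submodule R X where
  carrier := {x | ∀ r ∈ I, r • x ∈ N}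
  add_mem' := by
    intro a b ha hb r hr
    rw [smul_add]
    exact N.add_mem (ha r hr) (hb r hr)
  zero_mem' := by
    intro r hr
    rw [smul_zero]
    exact N.zero_mem
  smul_mem' := by
    intro c x hx r hr
    rw [smul_comm]
    exact N.smul_mem c (hx r hr)

/-- A submodule `N` of a module `X` over a local ring `(R, 𝔪)` is *Burch* if
`𝔪 • (N :_X 𝔪) ≠ 𝔪 • N`. -/
def Submodule.IsBurch {R X : Type u} [CommRing R] [IsLocalRing R] [AddCommGroup X]
    [Module R X] (N : Submodule R X) : Prop :=
  IsLocalRing.maximalIdeal R • N.colonBy (IsLocalRing.maximalIdeal R) ≠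
    IsLocalRing.maximalIdeal R • N

/-- `Tor_n^R(M, N) = 0`. -/
def TorIsZero (R : Type u) [CommRing R] (M N : Type u) [AddCommGroup M] [Module R M]
    [AddCommGroup N] [Module R N] (n : ℕ) : Prop :=
  Subsingleton (((Tor (ModuleCat.{u} R) n).obj (ModuleCat.of R M)).obj (ModuleCat.of R N))

/-- `Ext^n_R(M, N) = 0`. -/
def ExtIsZero (R : Type u) [CommRing R] (M N : Type u) [AddCommGroup M] [Module R M]
    [AddCommGroup N] [Module R N] (n : ℕ) : Prop :=
  Subsingleton
    (((Ext R (ModuleCat.{u} R) n).obj (Opposite.op (ModuleCat.of R M))).obj (ModuleCat.of R N))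

/-- `M` has projective dimension strictly less than `t`, i.e. `M` admits a projective
resolution vanishing in all degrees `≥ t`. -/
def HasProjDimLT (R : Type u) [CommRing R] (M : Type u) [AddCommGroup M] [Module R M]
    (t : ℕ) : Prop :=
  ∃ P : ProjectiveResolution (ModuleCat.of R M), ∀ i, t ≤ i → Limits.IsZero (P.complex.X i)

/-- `M` has injective dimension strictly less than `t`, i.e. `M` admits an injective
resolution vanishing in all degrees `≥ t`. -/
def HasInjDimLT (R : Type u) [CommRing R] (M : Type u) [AddCommGroup M] [Module R M]
    (t : ℕ) : Prop :=
  ∃ I : InjectiveResolution (ModuleCat.of R M), ∀ i, t ≤ i → Limits.IsZero (I.cocomplex.X i)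

/-- The depth of a module `M` over a local ring `(R, 𝔪, k)`: the smallest `i` such that
`Ext^i_R(k, M) ≠ 0` (and `⊤` if no such `i` exists). -/
noncomputable def moduleDepth (R : Type u) [CommRing R] [IsLocalRing R] (M : Type u)
    [AddCommGroup M] [Module R M] : ℕ∞ :=
  sInf {n : ℕ∞ | ∃ i : ℕ, n = (i : ℕ∞) ∧ ¬ ExtIsZero R (IsLocalRing.ResidueField R) M i}

section

open scoped TensorProduct

/-- The maps induced by `f` and `g` on the two factors of a tensor product commute. -/
theorem LinearMap.rTensor_lTensor_apply {R : Type*} [CommRing R] {A B C D : Type*}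
    [AddCommGroup A] [AddCommGroup B] [AddCommGroup C] [AddCommGroup D]
    [Module R A] [Module R B] [Module R C] [Module R D] (f : A →ₗ[R] B) (g : C →ₗ[R] D)
    (x : A ⊗[R] C) : f.rTensor D (g.lTensor A x) = g.lTensor B (f.rTensor C x) := by
  rw [← LinearMap.comp_apply, ← LinearMap.comp_apply, LinearMap.rTensor_comp_lTensor,
    LinearMap.lTensor_comp_rTensor]

namespace Submodule

variable {R : Type*} [CommRing R] {G N : Type*} [AddCommGroup G] [Module R G]
  [AddCommGroup N] [Module R N]

theorem tmul_mem_range_lTensor_subtype_smul_top {I : Ideal R} {x : G}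
    (hx : x ∈ I • (⊤ : Submodule R G)) (n : N) :
    x ⊗ₜ[R] n ∈ LinearMap.range ((I • (⊤ : Submodule R N)).subtype.lTensor G) := by
  suffices h : I • (⊤ : Submodule R G) ≤
      (LinearMap.range ((I • (⊤ : Submodule R N)).subtype.lTensor G)).comap
        ((TensorProduct.mk R G N).flip n) from h hx
  refine smul_le.mpr fun r hr g _ => ⟨g ⊗ₜ ⟨r • n, smul_mem_smul hr mem_top⟩, ?_⟩
  simp

theorem range_lTensor_subtype_smul_top_le (I : Ideal R) :
    LinearMap.range ((I • (⊤ : Submodule R N)).subtype.lTensor G) ≤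
      I • (⊤ : Submodule R (G ⊗[R] N)) := by
  rw [LinearMap.range_eq_map, ← TensorProduct.span_tmul_eq_top, map_span, span_le]
  rintro _ ⟨_, ⟨g, ⟨x, hx⟩, rfl⟩, rfl⟩
  suffices h : I • (⊤ : Submodule R N) ≤
      (I • (⊤ : Submodule R (G ⊗[R] N))).comap (TensorProduct.mk R G N g) from h hx
  refine smul_le.mpr fun r hr n _ => ?_
  rw [mem_comap, map_smul]
  exact smul_mem_smul hr mem_top

end Submodule

theorem Module.Free.eq_zero_of_forall_tmul_eq_zero {R : Type*} [CommRing R] {G N : Type*}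
    [AddCommGroup G] [Module R G] [AddCommGroup N] [Module R N] [Module.Free R G]
    (hN : Module.annihilator R N = ⊥) {x : G} (hx : ∀ n : N, x ⊗ₜ[R] n = 0) : x = 0 := by
  refine (Module.Free.chooseBasis R G).ext_elem fun i => ?_
  rw [map_zero, Finsupp.zero_apply, ← Submodule.mem_bot R, ← hN, Module.mem_annihilator]
  intro n
  simpa using congrArg (TensorProduct.lid R N)
    (congrArg (((Module.Free.chooseBasis R G).coord i).rTensor N) (hx n))

namespace IsLocalRing

open Submodule

variable {R : Type u} [CommRing R] [IsLocalRing R]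

/-- A finitely generated module over a local ring has a minimal free cover. -/
theorem exists_minimal_free_cover (K : Type u) [AddCommGroup K] [Module R K] [Module.Finite R K] :
    ∃ (ι : Type u) (_ : Finite ι) (π : (ι →₀ R) →ₗ[R] K), Function.Surjective π ∧
      LinearMap.ker π ≤ maximalIdeal R • ⊤ := by
  let b := Module.Free.chooseBasis (ResidueField R) (ResidueField R ⊗[R] K)
  have hsurj : Function.Surjective (TensorProduct.mk R (ResidueField R) K 1) :=
    TensorProduct.mk_surjective R K (ResidueField R) Ideal.Quotient.mk_surjective
  choose v hv using fun i => hsurj (b i)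
  refine ⟨_, Module.Finite.finite_basis b, Finsupp.linearCombination R v, ?_, fun x hx => ?_⟩
  · rw [← LinearMap.range_eq_top, Finsupp.range_linearCombination]
    exact span_eq_top_of_tmul_eq_basis v b hv
  · have hsum : Finsupp.linearCombination (ResidueField R) b
        (x.mapRange (residue R) (map_zero _)) = 0 := by
      have h0 := congrArg (TensorProduct.mk R (ResidueField R) K 1) (LinearMap.mem_ker.mp hx)
      rw [map_zero, Finsupp.linearCombination_apply, Finsupp.sum, map_sum] at h0
      rw [Finsupp.linearCombination_apply, Finsupp.sum_mapRange_index (by simp), ← h0]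
      refine Finset.sum_congr rfl fun j _ => ?_
      rw [map_smul, hv]
      exact algebraMap_smul (ResidueField R) (x j) (b j)
    have hzero := linearIndependent_iff.mp b.linearIndependent _ hsum
    rw [← Finsupp.sum_single x]
    refine sum_mem fun i _ => ?_
    have hi : x i ∈ maximalIdeal R := by
      simpa [residue_eq_zero_iff] using DFunLike.congr_fun hzero i
    rw [← mul_one (x i), ← smul_eq_mul, ← Finsupp.smul_single]
    exact smul_mem_smul hi mem_top

/-- A minimal free cover `π : G → K` is injective as soon as some `φ : K → F` with `F` flat stays
injective after tensoring with `𝔪N`, where `N` is faithful. -/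
theorem injective_of_ker_le_of_rTensor_injective [IsNoetherianRing R]
    {G K F N : Type*} [AddCommGroup G] [Module R G] [Module.Finite R G] [Module.Free R G]
    [AddCommGroup K] [Module R K] [AddCommGroup F] [Module R F] [Module.Flat R F]
    [AddCommGroup N] [Module R N] [Module.Finite R N]
    (hN : Module.annihilator R N = ⊥) {π : G →ₗ[R] K} (hπ : Function.Surjective π)
    (hmin : LinearMap.ker π ≤ maximalIdeal R • ⊤) (φ : K →ₗ[R] F)
    (hφ : Function.Injective (φ.rTensor ↥(maximalIdeal R • (⊤ : Submodule R N)))) :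
    Function.Injective π := by
  set X : Submodule R N := maximalIdeal R • (⊤ : Submodule R N)
  let j : LinearMap.ker π →ₗ[R] G := (LinearMap.ker π).subtype
  have hexact : Function.Exact j π := LinearMap.exact_subtype_ker_map π
  have hle : LinearMap.range (j.rTensor N) ≤
      maximalIdeal R • LinearMap.range (j.rTensor N) := by
    rw [LinearMap.range_eq_map, ← map_smul'', ← TensorProduct.span_tmul_eq_top, map_span, span_le,
      TensorProduct.span_tmul_eq_top]
    rintro _ ⟨_, ⟨x, n, rfl⟩, rfl⟩
    obtain ⟨y, hy⟩ := tmul_mem_range_lTensor_subtype_smul_top (hmin x.2) n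
    have hy0 : π.rTensor X y = 0 := by
      apply hφ
      apply Module.Flat.lTensor_preserves_injective_linearMap (M := F) X.subtype X.injective_subtype
      rw [map_zero, map_zero, ← LinearMap.rTensor_lTensor_apply, ← LinearMap.rTensor_lTensor_apply,
        hy]
      simp
    obtain ⟨w, rfl⟩ := (_root_.rTensor_exact X hexact hπ y).mp hy0
    refine ⟨_, range_lTensor_subtype_smul_top_le _ ⟨w, rfl⟩, ?_⟩
    rw [LinearMap.rTensor_lTensor_apply, hy]
    rfl
  have hbot : LinearMap.range (j.rTensor N) = ⊥ :=
    eq_bot_of_le_smul_of_le_jacobson_bot (maximalIdeal R) _ (IsNoetherian.noetherian _) hle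
      (maximalIdeal_le_jacobson ⊥)
  rw [injective_iff_map_eq_zero]
  refine fun x hx => Module.Free.eq_zero_of_forall_tmul_eq_zero hN fun n => ?_
  rw [LinearMap.range_eq_bot] at hbot
  exact LinearMap.congr_fun hbot ((⟨x, hx⟩ : LinearMap.ker π) ⊗ₜ n)

/-- If some `φ : K → F` with `F` flat stays injective after tensoring with `𝔪N`, where `N` is
faithful, then `K` is projective. -/
theorem projective_of_rTensor_injective [IsNoetherianRing R]
    {K : Type u} {F N : Type*} [AddCommGroup K] [Module R K] [Module.Finite R K]
    [AddCommGroup F] [Module R F] [Module.Flat R F]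
    [AddCommGroup N] [Module R N] [Module.Finite R N]
    (hN : Module.annihilator R N = ⊥) (φ : K →ₗ[R] F)
    (hφ : Function.Injective (φ.rTensor ↥(maximalIdeal R • (⊤ : Submodule R N)))) :
    Module.Projective R K := by
  obtain ⟨ι, _, π, hπ, hmin⟩ := exists_minimal_free_cover (R := R) K
  have hinj := injective_of_ker_le_of_rTensor_injective hN hπ hmin φ hφ
  exact Module.Projective.of_equiv (LinearEquiv.ofBijective π ⟨hinj, hπ⟩)

end IsLocalRing

/-- Let `0 → K → F → M → 0` be exact and `Q₂ → Q₁ → Q₀ → Y` a complex which is exact at `Q₀`, where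
`F` and `Q₀` are flat. If `M ⊗ Q₂ → M ⊗ Q₁ → M ⊗ Q₀` is exact, then an element of `K ⊗ Q₀` vanishing
in `F ⊗ Y` comes from `K ⊗ Q₁`. -/
theorem LinearMap.mem_range_lTensor_of_exact {R : Type*} [CommRing R]
    {K F M : Type*} [AddCommGroup K] [AddCommGroup F] [AddCommGroup M]
    [Module R K] [Module R F] [Module R M] [Module.Flat R F]
    {Q₂ Q₁ Q₀ Y : Type*} [AddCommGroup Q₂] [AddCommGroup Q₁] [AddCommGroup Q₀] [AddCommGroup Y]
    [Module R Q₂] [Module R Q₁] [Module R Q₀] [Module R Y] [Module.Flat R Q₀]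
    {i : K →ₗ[R] F} {p : F →ₗ[R] M} (hi : Function.Injective i) (hip : Function.Exact i p)
    (hp : Function.Surjective p)
    {d₂ : Q₂ →ₗ[R] Q₁} {d₁ : Q₁ →ₗ[R] Q₀} {d₀ : Q₀ →ₗ[R] Y}
    (hd₂ : d₁ ∘ₗ d₂ = 0) (hd : Function.Exact d₁ d₀)
    (hM : Function.Exact (d₂.lTensor M) (d₁.lTensor M))
    {z : K ⊗[R] Q₀} (hz : i.rTensor Y (d₀.lTensor K z) = 0) :
    z ∈ LinearMap.range (d₁.lTensor K) := by
  rw [LinearMap.rTensor_lTensor_apply] at hz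
  obtain ⟨w, hw⟩ := (Module.Flat.lTensor_exact F hd _).mp hz
  have hcyc : d₁.lTensor M (p.rTensor Q₁ w) = 0 := by
    rw [← LinearMap.rTensor_lTensor_apply, hw, (rTensor_exact Q₀ hip hp).apply_apply_eq_zero]
  obtain ⟨v', hv'⟩ := (hM _).mp hcyc
  obtain ⟨v, rfl⟩ := LinearMap.rTensor_surjective Q₂ hp v'
  have hker : p.rTensor Q₁ (w - d₂.lTensor F v) = 0 := by
    rw [map_sub, LinearMap.rTensor_lTensor_apply, hv', sub_self]
  obtain ⟨u, hu⟩ := (rTensor_exact Q₁ hip hp _).mp hker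
  refine ⟨u, Module.Flat.rTensor_preserves_injective_linearMap (M := Q₀) i hi ?_⟩
  rw [LinearMap.rTensor_lTensor_apply, hu, map_sub, hw,
    ← LinearMap.comp_apply (d₁.lTensor F), ← LinearMap.lTensor_comp, hd₂]
  simp

/-- If moreover `Q₀ → Y` is surjective, then `K ⊗ Y → F ⊗ Y` is injective. -/
theorem LinearMap.rTensor_injective_of_exact {R : Type*} [CommRing R]
    {K F M : Type*} [AddCommGroup K] [AddCommGroup F] [AddCommGroup M]
    [Module R K] [Module R F] [Module R M] [Module.Flat R F]
    {Q₂ Q₁ Q₀ Y : Type*} [AddCommGroup Q₂] [AddCommGroup Q₁] [AddCommGroup Q₀] [AddCommGroup Y]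
    [Module R Q₂] [Module R Q₁] [Module R Q₀] [Module R Y] [Module.Flat R Q₀]
    {i : K →ₗ[R] F} {p : F →ₗ[R] M} (hi : Function.Injective i) (hip : Function.Exact i p)
    (hp : Function.Surjective p)
    {d₂ : Q₂ →ₗ[R] Q₁} {d₁ : Q₁ →ₗ[R] Q₀} {d₀ : Q₀ →ₗ[R] Y}
    (hd₂ : d₁ ∘ₗ d₂ = 0) (hd : Function.Exact d₁ d₀) (hd₀ : Function.Surjective d₀)
    (hM : Function.Exact (d₂.lTensor M) (d₁.lTensor M)) :
    Function.Injective (i.rTensor Y) := by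
  rw [injective_iff_map_eq_zero]
  intro y hy
  obtain ⟨z, rfl⟩ := LinearMap.lTensor_surjective K hd₀ y
  obtain ⟨u, rfl⟩ := LinearMap.mem_range_lTensor_of_exact hi hip hp hd₂ hd hM hy
  exact (lTensor_exact K hd hd₀).apply_apply_eq_zero u

/-- Exactness of `M ⊗ Q₂ → M ⊗ Q₁ → M ⊗ Q₀` shifts to exactness of `K ⊗ Q₁ → K ⊗ Q₀ → K ⊗ Y`. -/
theorem LinearMap.exact_lTensor_of_exact {R : Type*} [CommRing R]
    {K F M : Type*} [AddCommGroup K] [AddCommGroup F] [AddCommGroup M]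
    [Module R K] [Module R F] [Module R M] [Module.Flat R F]
    {Q₂ Q₁ Q₀ Y : Type*} [AddCommGroup Q₂] [AddCommGroup Q₁] [AddCommGroup Q₀] [AddCommGroup Y]
    [Module R Q₂] [Module R Q₁] [Module R Q₀] [Module R Y] [Module.Flat R Q₀]
    {i : K →ₗ[R] F} {p : F →ₗ[R] M} (hi : Function.Injective i) (hip : Function.Exact i p)
    (hp : Function.Surjective p)
    {d₂ : Q₂ →ₗ[R] Q₁} {d₁ : Q₁ →ₗ[R] Q₀} {d₀ : Q₀ →ₗ[R] Y}
    (hd₂ : d₁ ∘ₗ d₂ = 0) (hd : Function.Exact d₁ d₀)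
    (hM : Function.Exact (d₂.lTensor M) (d₁.lTensor M)) :
    Function.Exact (d₁.lTensor K) (d₀.lTensor K) := by
  refine fun z => ⟨fun hz => ?_, ?_⟩
  · exact LinearMap.mem_range_lTensor_of_exact hi hip hp hd₂ hd hM (by rw [hz, map_zero])
  · rintro ⟨u, rfl⟩
    rw [← LinearMap.comp_apply, ← LinearMap.lTensor_comp, hd.linearMap_comp_eq_zero,
      LinearMap.lTensor_zero, LinearMap.zero_apply]

theorem hasProjDimLT_one_of_projective {R : Type u} [CommRing R] {M : Type u} [AddCommGroup M]
    [Module R M] [Module.Projective R M] : HasProjDimLT R M 1 := by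
  have : Projective (ModuleCat.of R M) := (IsProjective.iff_projective M).mp inferInstance
  refine ⟨ProjectiveResolution.self (ModuleCat.of R M), fun i hi => ?_⟩
  obtain ⟨i, rfl⟩ := Nat.exists_eq_add_of_le' hi
  exact HomologicalComplex.isZero_single_obj_X _ _ _ _ (by simp)

namespace CategoryTheory.ProjectiveResolution

variable {C : Type*} [Category* C] [Abelian C]

/-- The augmentation of a projective resolution. -/
noncomputable def augmentation {Z : C} (P : ProjectiveResolution Z) : P.complex.X 0 ⟶ Z := P.π.f 0

instance {Z : C} (P : ProjectiveResolution Z) : Epi P.augmentation :=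
  inferInstanceAs (Epi (P.π.f 0))

@[simp]
lemma d_augmentation {Z : C} (P : ProjectiveResolution Z) :
    P.complex.d 1 0 ≫ P.augmentation = 0 := P.complex_d_comp_π_f_zero

@[simp]
lemma d_augmentation_assoc {Z Y : C} (P : ProjectiveResolution Z) (f : Z ⟶ Y) :
    P.complex.d 1 0 ≫ P.augmentation ≫ f = 0 := by
  rw [← Category.assoc, d_augmentation, Limits.zero_comp]

lemma exact_augmentation {Z : C} (P : ProjectiveResolution Z) :
    (ShortComplex.mk _ _ P.d_augmentation).Exact := P.exact₀

lemma augmentation_comp_f_comp_g (S : ShortComplex C) (P : ProjectiveResolution S.X₁) :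
    (P.augmentation ≫ S.f) ≫ S.g = 0 := by simp

/-- A projective resolution of the kernel of an epimorphism from a projective object, extended to a
resolution of the target. -/
noncomputable def splice {S : ShortComplex C} (hS : S.ShortExact) [Projective S.X₂]
    (P : ProjectiveResolution S.X₁) : ProjectiveResolution S.X₃ where
  complex := ChainComplex.augment P.complex (P.augmentation ≫ S.f) (by simp)
  projective := by
    rintro (_ | n)
    · exact inferInstanceAs (Projective S.X₂)
    · exact P.projective n
  π := (ChainComplex.toSingle₀Equiv _ _).symm ⟨S.g, P.augmentation_comp_f_comp_g S⟩
  quasiIso := ⟨fun n => by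
    have := hS.mono_f
    have := hS.epi_g
    have hπ := ChainComplex.toSingle₀Equiv_symm_apply_f_zero
      (C := ChainComplex.augment P.complex (P.augmentation ≫ S.f) (by simp)) (X := S.X₃)
      S.g (P.augmentation_comp_f_comp_g S)
    rcases n with (_ | n)
    · rw [ChainComplex.quasiIsoAt₀_iff, ShortComplex.quasiIso_iff_of_zeros']
      · refine (ShortComplex.exact_and_epi_g_iff_of_iso
          (S₂ := ShortComplex.mk (P.augmentation ≫ S.f) S.g (by simp)) ?_).2
          ⟨?_, hS.epi_g⟩
        · exact ShortComplex.isoMk (Iso.refl _) (Iso.refl _) (Iso.refl _)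
            ((Category.id_comp _).trans (Category.comp_id _).symm)
            ((Category.id_comp _).trans (hπ.symm.trans (Category.comp_id _).symm))
        · let φ : ShortComplex.mk (P.augmentation ≫ S.f) S.g (by simp) ⟶ S :=
            { τ₁ := P.augmentation, τ₂ := 𝟙 _, τ₃ := 𝟙 _ }
          exact (ShortComplex.exact_iff_of_epi_of_isIso_of_mono φ).mpr hS.exact
      all_goals rfl
    · rw [quasiIsoAt_iff_exactAt' _ _ (ChainComplex.exactAt_succ_single_obj _ _),
        HomologicalComplex.exactAt_iff' _ (n + 1 + 1) (n + 1) n (by simp) (by simp)]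
      rcases n with (_ | n)
      · let φ : ShortComplex.mk _ _ P.d_augmentation ⟶
            ShortComplex.mk (P.complex.d 1 0) (P.augmentation ≫ S.f) (by simp) :=
            { τ₁ := 𝟙 _, τ₂ := 𝟙 _, τ₃ := S.f }
        exact (ShortComplex.exact_iff_of_epi_of_isIso_of_mono φ).mp P.exact_augmentation
      · exact P.exact_succ n⟩

end CategoryTheory.ProjectiveResolution

/-- If `0 → K → F → M → 0` is exact with `F` projective, then `pd M ≤ pd K + 1`. -/
theorem HasProjDimLT.of_exact {R : Type u} [CommRing R] {K F M : Type u}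
    [AddCommGroup K] [AddCommGroup F] [AddCommGroup M] [Module R K] [Module R F] [Module R M]
    [Module.Projective R F]
    {i : K →ₗ[R] F} {p : F →ₗ[R] M} (hi : Function.Injective i) (hip : Function.Exact i p)
    (hp : Function.Surjective p) {n : ℕ} (hK : HasProjDimLT R K n) : HasProjDimLT R M (n + 1) := by
  obtain ⟨P, hP⟩ := hK
  let S : ShortComplex (ModuleCat.{u} R) := ShortComplex.mk (ModuleCat.ofHom i) (ModuleCat.ofHom p)
    (by ext x; exact hip.apply_apply_eq_zero x)
  have hS : S.ShortExact := ModuleCat.shortComplex_shortExact S hip hi hp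
  have : Projective S.X₂ := (IsProjective.iff_projective F).mp inferInstance
  refine ⟨P.splice hS, fun k hk => ?_⟩
  obtain ⟨k, rfl⟩ := Nat.exists_eq_add_of_le' (Nat.le_of_add_left_le hk)
  exact hP k (by omega)

/-- `Tor_{n+1}(M, X) = 0` in terms of a projective resolution of `X`. -/
theorem exact_lTensor_of_torIsZero_succ {R : Type u} [CommRing R] {M X : Type u} [AddCommGroup M]
    [Module R M] [AddCommGroup X] [Module R X] (P : ProjectiveResolution (ModuleCat.of R X)) {n : ℕ}
    (h : TorIsZero R M X (n + 1)) :
    Function.Exact ((P.complex.d (n + 2) (n + 1)).hom.lTensor M)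
      ((P.complex.d (n + 1) n).hom.lTensor M) := by
  have : Subsingleton _ := h
  have hz := (ModuleCat.isZero_of_subsingleton
    (((Tor (ModuleCat.{u} R) (n + 1)).obj (ModuleCat.of R M)).obj (ModuleCat.of R X))).of_iso
    (P.isoLeftDerivedObj ((MonoidalCategory.tensoringLeft _).obj (ModuleCat.of R M)) (n + 1)).symm
  have hz' := (HomologicalComplex.exactAt_iff_isZero_homology _ _).mpr hz
  rw [HomologicalComplex.exactAt_iff' _ (n + 1 + 1) (n + 1) n (by simp) (by simp)] at hz'
  exact (ShortComplex.ShortExact.moduleCat_exact_iff_function_exact _).mp hz'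

theorem subsingleton_tensorProduct_of_torIsZero_zero {R : Type u} [CommRing R] {M X : Type u}
    [AddCommGroup M] [Module R M] [AddCommGroup X] [Module R X] (h : TorIsZero R M X 0) :
    Subsingleton (M ⊗[R] X) := by
  have : Subsingleton _ := h
  exact ModuleCat.subsingleton_of_isZero ((ModuleCat.isZero_of_subsingleton
    (((Tor (ModuleCat.{u} R) 0).obj (ModuleCat.of R M)).obj (ModuleCat.of R X))).of_iso
    ((((MonoidalCategory.tensoringLeft (ModuleCat.{u} R)).obj
      (ModuleCat.of R M)).leftDerivedZeroIsoSelf.app (ModuleCat.of R X))).symm)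

/-- A finitely generated module over a Noetherian ring is the quotient of a projective module by a
finitely generated submodule. -/
theorem Module.Finite.exists_exact_projective (R : Type u) [CommRing R] [IsNoetherianRing R]
    (M : Type u) [AddCommGroup M] [Module R M] [Module.Finite R M] :
    ∃ (K F : Type u) (_ : AddCommGroup K) (_ : AddCommGroup F) (_ : Module R K) (_ : Module R F)
      (i : K →ₗ[R] F) (p : F →ₗ[R] M), Module.Finite R K ∧ Module.Projective R F ∧
        Function.Injective i ∧ Function.Exact i p ∧ Function.Surjective p := by
  obtain ⟨n, p, hp⟩ := Module.Finite.exists_fin' R M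
  exact ⟨LinearMap.ker p, Fin n → R, inferInstance, inferInstance, inferInstance, inferInstance,
    (LinearMap.ker p).subtype, p, inferInstance, inferInstance, (LinearMap.ker p).injective_subtype,
    LinearMap.exact_subtype_ker_map p, hp⟩

/-- If `N` is faithful and a projective resolution of `𝔪N` stays exact in degree `n + 1` after
tensoring with `M`, then `pd M ≤ n + 1`. -/
theorem HasProjDimLT.of_exact_lTensor
    {R : Type u} [CommRing R] [IsNoetherianRing R] [IsLocalRing R]
    {N : Type u} [AddCommGroup N] [Module R N] [Module.Finite R N]
    (hN : Module.annihilator R N = ⊥)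
    (P : ProjectiveResolution
      (ModuleCat.of R ↥(IsLocalRing.maximalIdeal R • (⊤ : Submodule R N)))) (n : ℕ)
    {M : Type u} [AddCommGroup M] [Module R M] [Module.Finite R M]
    (hM : Function.Exact ((P.complex.d (n + 2) (n + 1)).hom.lTensor M)
      ((P.complex.d (n + 1) n).hom.lTensor M)) :
    HasProjDimLT R M (n + 2) := by
  have hproj (k : ℕ) : Module.Projective R (P.complex.X k) :=
    (IsProjective.iff_projective _).mpr (P.projective k)
  have hcomp (k : ℕ) :
      (P.complex.d (k + 1) k).hom ∘ₗ (P.complex.d (k + 2) (k + 1)).hom = 0 := by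
    rw [← ModuleCat.hom_comp, P.complex.d_comp_d, ModuleCat.hom_zero]
  induction n generalizing M with
  | zero =>
    obtain ⟨K, F, _, _, _, _, i, p, _, _, hi, hip, hp⟩ :=
      Module.Finite.exists_exact_projective R M
    have hε : Function.Surjective P.augmentation.hom :=
      (ModuleCat.epi_iff_surjective _).mp inferInstance
    have hd : Function.Exact (P.complex.d 1 0).hom P.augmentation.hom :=
      (ShortComplex.ShortExact.moduleCat_exact_iff_function_exact _).mp P.exact_augmentation
    have : Module.Projective R K := IsLocalRing.projective_of_rTensor_injective hN i
      (LinearMap.rTensor_injective_of_exact hi hip hp (hcomp 0) hd hε hM)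
    exact HasProjDimLT.of_exact hi hip hp hasProjDimLT_one_of_projective
  | succ n ih =>
    obtain ⟨K, F, _, _, _, _, i, p, _, _, hi, hip, hp⟩ :=
      Module.Finite.exists_exact_projective R M
    have hd : Function.Exact (P.complex.d (n + 2) (n + 1)).hom (P.complex.d (n + 1) n).hom :=
      (ShortComplex.ShortExact.moduleCat_exact_iff_function_exact _).mp (P.exact_succ n)
    exact HasProjDimLT.of_exact hi hip hp
      (ih (LinearMap.exact_lTensor_of_exact hi hip hp (hcomp (n + 1)) hd hM))

end

/-- Over a Noetherian local ring `(R, 𝔪)`, if `M`, `N` are finitely generated,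
`N` is faithful, `t ≥ 0` and `Tor_t^R(M, 𝔪N) = 0`, then `pd_R M ≤ t`. -/
theorem tor_vanishing_mN_faithful
    {R : Type u} [CommRing R] [IsNoetherianRing R] [IsLocalRing R]
    {M : Type u} [AddCommGroup M] [Module R M] [Module.Finite R M]
    {N : Type u} [AddCommGroup N] [Module R N] [Module.Finite R N]
    (hfaith : Module.annihilator R N = ⊥)
    (t : ℕ)
    (h : TorIsZero R M (↥(IsLocalRing.maximalIdeal R • (⊤ : Submodule R N))) t) :
    HasProjDimLT R M (t + 1) := by
  obtain _ | n := t
  · have := subsingleton_tensorProduct_of_torIsZero_zero h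
    have := IsLocalRing.projective_of_rTensor_injective hfaith (0 : M →ₗ[R] R)
      (Function.injective_of_subsingleton _)
    exact hasProjDimLT_one_of_projective
  · exact HasProjDimLT.of_exact_lTensor hfaith (projectiveResolution _) n
      (exact_lTensor_of_torIsZero_succ _ h)
end

section
/- Let (R,m,k) be a commutative Noetherian local ring, let M and X be finitely generated R-modules, and let N be a submodule of X that is faithful as an R-module (i.e., Ann_R(N) = 0). If t ≥ 1 is an integer such that Tor_t^R(M, X/mN) = 0, then the projective dimension of M is strictly less than t. -/
open CategoryTheory

universe u

open TensorProduct in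
theorem LinearMap.rTensor_lTensor_apply_comm {R A B C D : Type*} [CommRing R]
    [AddCommGroup A] [Module R A] [AddCommGroup B] [Module R B]
    [AddCommGroup C] [Module R C] [AddCommGroup D] [Module R D]
    (f : A →ₗ[R] B) (g : C →ₗ[R] D) (z : A ⊗[R] C) :
    f.rTensor D (g.lTensor A z) = g.lTensor B (f.rTensor C z) := by
  rw [← LinearMap.comp_apply, ← LinearMap.comp_apply, LinearMap.rTensor_comp_lTensor,
    LinearMap.lTensor_comp_rTensor]

open TensorProduct in
/-- If `K → F → M → 0` is exact, `M ⊗ P₃ → M ⊗ P₂ → M ⊗ P₁` is exact and `K ⊗ P₁ → F ⊗ P₁` is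
injective, then an element of `K ⊗ P₁` whose image in `F ⊗ P₁` is a boundary is itself a boundary. -/
theorem LinearMap.exists_lTensor_eq_of_rTensor_eq_lTensor
    {R K F M P₃ P₂ P₁ : Type*} [CommRing R] [AddCommGroup K] [Module R K]
    [AddCommGroup F] [Module R F] [AddCommGroup M] [Module R M]
    [AddCommGroup P₃] [Module R P₃] [AddCommGroup P₂] [Module R P₂]
    [AddCommGroup P₁] [Module R P₁]
    {i : K →ₗ[R] F} {p : F →ₗ[R] M} (hip : Function.Exact i p) (hp : Function.Surjective p)
    {d₃ : P₃ →ₗ[R] P₂} {d₂ : P₂ →ₗ[R] P₁} (hd : d₂ ∘ₗ d₃ = 0)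
    (hM : Function.Exact (d₃.lTensor M) (d₂.lTensor M))
    (hi : Function.Injective (i.rTensor P₁))
    {x : K ⊗[R] P₁} {y : F ⊗[R] P₂} (hxy : i.rTensor P₁ x = d₂.lTensor F y) :
    ∃ u, d₂.lTensor K u = x := by
  have hpi (z : K ⊗[R] P₁) : p.rTensor P₁ (i.rTensor P₁ z) = 0 :=
    (rTensor_exact P₁ hip hp).apply_apply_eq_zero z
  obtain ⟨w, hw⟩ := (hM (p.rTensor P₂ y)).mp
    (by rw [← LinearMap.rTensor_lTensor_apply_comm, ← hxy, hpi])
  obtain ⟨v, rfl⟩ := LinearMap.rTensor_surjective P₃ hp w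
  obtain ⟨u, hu⟩ := (rTensor_exact P₂ hip hp (y - d₃.lTensor F v)).mp
    (by rw [map_sub, LinearMap.rTensor_lTensor_apply_comm, hw, sub_self])
  refine ⟨u, hi ?_⟩
  rw [LinearMap.rTensor_lTensor_apply_comm, hu, map_sub, ← LinearMap.comp_apply,
    ← LinearMap.lTensor_comp, hd, hxy]
  simp

/-- A finite module over a local ring is the quotient of a finite free module by a submodule
contained in `𝔪` times the free module. -/
theorem IsLocalRing.exists_surjective_ker_le_smul_top (R M : Type*) [CommRing R] [IsLocalRing R]
    [AddCommGroup M] [Module R M] [Module.Finite R M] :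
    ∃ (n : ℕ) (p : (Fin n → R) →ₗ[R] M), Function.Surjective p ∧
      LinearMap.ker p ≤ maximalIdeal R • (⊤ : Submodule R (Fin n → R)) := by
  let b := Module.finBasis (ResidueField R) (TensorProduct R (ResidueField R) M)
  choose f hf using fun i => TensorProduct.mk_surjective R M (ResidueField R)
    Ideal.Quotient.mk_surjective (b i)
  refine ⟨_, Fintype.linearCombination R f, ?_, ?_⟩
  · rw [← LinearMap.range_eq_top, Fintype.range_linearCombination]
    exact span_eq_top_of_tmul_eq_basis f b hf
  · intro a ha
    have key : ∑ i, residue R (a i) • b i = 0 := by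
      have := congrArg (TensorProduct.mk R (ResidueField R) M 1) (LinearMap.mem_ker.mp ha)
      rw [Fintype.linearCombination_apply, map_sum, map_zero] at this
      rw [← this]
      refine Finset.sum_congr rfl fun i _ => ?_
      rw [map_smul, hf, ← IsScalarTower.algebraMap_smul (ResidueField R) (a i) (b i)]
      rfl
    have hzero := Fintype.linearIndependent_iff.mp b.linearIndependent _ key
    rw [pi_eq_sum_univ' a]
    refine Submodule.sum_mem _ fun i _ => Submodule.smul_mem_smul ?_ trivial
    exact (residue_eq_zero_iff _).mp (hzero i)

open TensorProduct in
/-- If `K ⊆ 𝔪F` with `F` finite free, `N ⊆ X` is faithful, and `K ⊗ X/𝔪N → F ⊗ X/𝔪N` is injective,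
then `K = 0`. -/
theorem IsLocalRing.eq_bot_of_rTensor_quotient_injective {R X : Type*} [CommRing R]
    [IsNoetherianRing R] [IsLocalRing R] [AddCommGroup X] [Module R X] [Module.Finite R X]
    {N : Submodule R X} (hN : N.annihilator = ⊥) {n : ℕ} {K : Submodule R (Fin n → R)}
    (hK : K ≤ maximalIdeal R • (⊤ : Submodule R (Fin n → R)))
    (hinj : Function.Injective (K.subtype.rTensor (X ⧸ (maximalIdeal R • N)))) :
    K = ⊥ := by
  set Q := maximalIdeal R • N
  have hFz (z : Fin n → R) (hz : z ∈ maximalIdeal R • (⊤ : Submodule R (Fin n → R))) (x : X)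
      (hx : x ∈ N) : z ⊗ₜ[R] Q.mkQ x = 0 := by
    induction hz using Submodule.smul_induction_on' with
    | smul a ha y _ =>
      have hax : Q.mkQ (a • x) = 0 :=
        (Submodule.Quotient.mk_eq_zero Q).mpr (Submodule.smul_mem_smul ha hx)
      rw [smul_tmul, ← map_smul, hax, tmul_zero]
    | add y _ z _ hy hz => rw [add_tmul, hy, hz, add_zero]
  have hKz (z : K) (x : X) (hx : x ∈ N) : z ⊗ₜ[R] Q.mkQ x = 0 :=
    hinj (by simpa using hFz z (hK z.2) x hx)
  set T := LinearMap.range (N.subtype.lTensor K)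
  have hQT : LinearMap.range (Q.subtype.lTensor K) ≤ maximalIdeal R • T := by
    rintro _ ⟨w, rfl⟩
    induction w using TensorProduct.induction_on with
    | zero => simp
    | add y z hy hz => rw [map_add]; exact add_mem hy hz
    | tmul z q =>
      obtain ⟨q, hq⟩ := q
      change z ⊗ₜ[R] q ∈ _
      induction hq using Submodule.smul_induction_on' with
      | smul a ha y hy =>
        rw [tmul_smul]
        exact Submodule.smul_mem_smul ha ⟨z ⊗ₜ ⟨y, hy⟩, rfl⟩
      | add y _ w _ hy hw => rw [tmul_add]; exact add_mem hy hw
  have hT : T ≤ maximalIdeal R • T := by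
    refine le_trans ?_ hQT
    rintro _ ⟨w, rfl⟩
    induction w using TensorProduct.induction_on with
    | zero => simp
    | add y z hy hz => rw [map_add]; exact add_mem hy hz
    | tmul z x =>
      exact (lTensor_exact K (LinearMap.exact_subtype_mkQ Q) Q.mkQ_surjective _).mp
        (by simpa using hKz z x x.2)
  have : IsNoetherian R (K ⊗[R] X) := isNoetherian_of_isNoetherianRing_of_finite R (K ⊗[R] X)
  have hT0 : T = ⊥ := Submodule.eq_bot_of_le_smul_of_le_jacobson_bot (M := K ⊗[R] X)
    (maximalIdeal R) T
    (IsNoetherian.noetherian T) hT (maximalIdeal_le_jacobson _)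
  rw [eq_bot_iff]
  intro z hz
  rw [Submodule.mem_bot]
  ext j
  rw [Pi.zero_apply, ← Submodule.mem_bot R, ← hN, Submodule.mem_annihilator]
  intro x hx
  have h0 : (⟨z, hz⟩ : K) ⊗ₜ[R] x = 0 := by
    rw [← Submodule.mem_bot R, ← hT0]
    exact ⟨⟨z, hz⟩ ⊗ₜ ⟨x, hx⟩, rfl⟩
  simpa using congrArg
    (TensorProduct.lid R X ∘ (LinearMap.proj j ∘ₗ K.subtype : K →ₗ[R] R).rTensor X) h0

/-- A complex of projectives with an exact augmentation is a projective resolution. -/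
noncomputable def CategoryTheory.ProjectiveResolution.ofExact {C : Type*} [Category* C] [Abelian C]
    {Z : C} (P : ChainComplex C ℕ) [∀ n, Projective (P.X n)] (f : P.X 0 ⟶ Z) [Epi f]
    (w : P.d 1 0 ≫ f = 0) (h₀ : (ShortComplex.mk _ _ w).Exact)
    (h : ∀ n, P.ExactAt (n + 1)) : ProjectiveResolution Z where
  complex := P
  π := (ChainComplex.toSingle₀Equiv _ _).symm ⟨f, w⟩
  quasiIso := ⟨fun n => by
    cases n
    · rw [ChainComplex.quasiIsoAt₀_iff, ShortComplex.quasiIso_iff_of_zeros'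
        (hg₁ := P.shape 0 0 (by simp)) (hf₂ := rfl) (hg₂ := rfl)]
      refine (ShortComplex.exact_and_epi_g_iff_of_iso (S₂ := .mk _ _ w) ?_).mpr ⟨h₀, inferInstance⟩
      exact ShortComplex.isoMk (Iso.refl _) (Iso.refl _) (Iso.refl _)
        ((Category.id_comp _).trans (Category.comp_id _).symm)
        ((Category.id_comp _).trans ((Category.comp_id _).trans
          (ChainComplex.toSingle₀Equiv_symm_apply_f_zero f w)).symm)
    · rw [quasiIsoAt_iff_exactAt']
      · apply h
      · apply ChainComplex.exactAt_succ_single_obj⟩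

/-- The resolution of the cokernel of a short exact sequence with projective middle term obtained by
splicing in a resolution of its kernel. -/
theorem CategoryTheory.ShortComplex.ShortExact.exists_projectiveResolution
    {C : Type*} [Category* C] [Abelian C] {S : ShortComplex C} (hS : S.ShortExact)
    [Projective S.X₂] (P : ProjectiveResolution S.X₁) :
    ∃ Q : ProjectiveResolution S.X₃, ∀ n, Q.complex.X (n + 1) = P.complex.X n := by
  have hf := hS.mono_f
  have hg := hS.epi_g
  let ε : P.complex.X 0 ⟶ S.X₁ := P.π.f 0
  have hε : P.complex.d 1 0 ≫ ε = 0 := P.complex_d_comp_π_f_zero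
  have w : P.complex.d 1 0 ≫ ε ≫ S.f = 0 := by
    rw [← Category.assoc, hε, Limits.zero_comp]
  let A := ChainComplex.augment P.complex (ε ≫ S.f) w
  have : ∀ n, Projective (A.X n)
    | 0 => inferInstanceAs (Projective S.X₂)
    | n + 1 => inferInstanceAs (Projective (P.complex.X n))
  let q : A.X 0 ⟶ S.X₃ := S.g
  have : Epi q := hg
  have w' : A.d 1 0 ≫ q = 0 := by
    change (ε ≫ S.f) ≫ S.g = 0
    simp
  refine ⟨.ofExact A q w' ?_ ?_, fun _ => rfl⟩
  · let φ : ShortComplex.mk (A.d 1 0) q w' ⟶ S :=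
      { τ₁ := ε, τ₂ := 𝟙 _, τ₃ := 𝟙 _,
        comm₁₂ := (Category.comp_id (ε ≫ S.f)).symm }
    have : Epi φ.τ₁ := inferInstanceAs (Epi (P.π.f 0))
    have : IsIso φ.τ₂ := inferInstanceAs (IsIso (𝟙 _))
    have : Mono φ.τ₃ := inferInstanceAs (Mono (𝟙 _))
    exact (ShortComplex.exact_iff_of_epi_of_isIso_of_mono φ).mpr hS.exact
  · rintro (_ | n)
    · rw [HomologicalComplex.exactAt_iff' _ 2 1 0 (by simp) (by simp)]
      let φ : ShortComplex.mk _ _ hε ⟶ A.sc' 2 1 0 :=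
        { τ₁ := 𝟙 _, τ₂ := 𝟙 _, τ₃ := S.f,
          comm₁₂ := (Category.id_comp _).trans (Category.comp_id _).symm
          comm₂₃ := Category.id_comp _ }
      have : Epi φ.τ₁ := inferInstanceAs (Epi (𝟙 _))
      have : IsIso φ.τ₂ := inferInstanceAs (IsIso (𝟙 _))
      have : Mono φ.τ₃ := inferInstanceAs (Mono S.f)
      exact (ShortComplex.exact_iff_of_epi_of_isIso_of_mono φ).mp P.exact₀
    · rw [HomologicalComplex.exactAt_iff' _ (n + 3) (n + 2) (n + 1) (by simp) (by simp)]
      exact P.exact_succ n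

theorem HasProjDimLT.of_projective {R M : Type u} [CommRing R] [AddCommGroup M] [Module R M]
    [Module.Projective R M] : HasProjDimLT R M 1 := by
  have : Projective (ModuleCat.of R M) :=
    (IsProjective.iff_projective M).mp inferInstance
  refine ⟨.self _, fun i hi => ?_⟩
  obtain ⟨i, rfl⟩ := Nat.exists_eq_add_of_le' hi
  exact HomologicalComplex.isZero_single_obj_X _ _ _ _ (by simp)

theorem HasProjDimLT.succ_of_exact {R K F M : Type u} [CommRing R] [AddCommGroup K] [Module R K]
    [AddCommGroup F] [Module R F] [AddCommGroup M] [Module R M] [Module.Projective R F]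
    {i : K →ₗ[R] F} {p : F →ₗ[R] M} (hi : Function.Injective i) (hip : Function.Exact i p)
    (hp : Function.Surjective p) {t : ℕ} (hK : HasProjDimLT R K t) :
    HasProjDimLT R M (t + 1) := by
  let S : ShortComplex (ModuleCat.{u} R) :=
    ShortComplex.mk (ModuleCat.ofHom i) (ModuleCat.ofHom p)
      (ModuleCat.hom_ext hip.linearMap_comp_eq_zero)
  have hS : S.ShortExact :=
    { exact := (ShortComplex.ShortExact.moduleCat_exact_iff_function_exact S).mpr hip
      mono_f := (ModuleCat.mono_iff_injective _).mpr hi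
      epi_g := (ModuleCat.epi_iff_surjective _).mpr hp }
  have : Projective S.X₂ := (IsProjective.iff_projective F).mp inferInstance
  obtain ⟨P, hP⟩ := hK
  obtain ⟨Q, hQ⟩ := hS.exists_projectiveResolution P
  refine ⟨Q, fun j hj => ?_⟩
  obtain ⟨j, rfl⟩ := Nat.exists_eq_add_of_le' ((Nat.le_add_left 1 t).trans hj)
  rw [hQ]
  exact hP j (by omega)

theorem torIsZero_succ_iff_exact {R M Y : Type u} [CommRing R] [AddCommGroup M] [Module R M]
    [AddCommGroup Y] [Module R Y] (P : ProjectiveResolution (ModuleCat.of R Y)) (n : ℕ) :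
    TorIsZero R M Y (n + 1) ↔ Function.Exact ((P.complex.d (n + 2) (n + 1)).hom.lTensor M)
      ((P.complex.d (n + 1) n).hom.lTensor M) := by
  let G := (MonoidalCategory.tensoringLeft (ModuleCat.{u} R)).obj (ModuleCat.of R M)
  let e := P.isoLeftDerivedObj G (n + 1)
  have h1 : TorIsZero R M Y (n + 1) ↔
      ((G.mapHomologicalComplex _).obj P.complex).ExactAt (n + 1) := by
    rw [HomologicalComplex.exactAt_iff_isZero_homology]
    exact ModuleCat.isZero_iff_subsingleton.symm.trans e.isZero_iff
  rw [h1, HomologicalComplex.exactAt_iff' _ (n + 2) (n + 1) n (by simp) (by simp),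
    ShortComplex.ShortExact.moduleCat_exact_iff_function_exact]
  rfl

/-- Over a Noetherian local ring `(R, 𝔪)`, let `M`, `X` be finitely generated
and let `N` be a submodule of `X` which is faithful as an `R`-module. If `t ≥ 1` and
`Tor_t^R(M, X/𝔪N) = 0`, then `pd_R M < t`. -/
theorem tor_vanishing_quotient_mN_faithful
    {R : Type u} [CommRing R] [IsNoetherianRing R] [IsLocalRing R]
    {M : Type u} [AddCommGroup M] [Module R M] [Module.Finite R M]
    {X : Type u} [AddCommGroup X] [Module R X] [Module.Finite R X]
    (N : Submodule R X) (hfaith : N.annihilator = ⊥)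
    (t : ℕ) (ht : 1 ≤ t)
    (h : TorIsZero R M (X ⧸ (IsLocalRing.maximalIdeal R • N)) t) :
    HasProjDimLT R M t := by
  let P := projectiveResolution (ModuleCat.of R (X ⧸ (IsLocalRing.maximalIdeal R • N)))
  have hflat (n : ℕ) : Module.Flat R (P.complex.X n) :=
    have : Module.Projective R (P.complex.X n) :=
      (IsProjective.iff_projective (P.complex.X n)).mpr (P.projective n)
    inferInstance
  have hdd (n : ℕ) : (P.complex.d (n + 1) n).hom ∘ₗ (P.complex.d (n + 2) (n + 1)).hom = 0 := by
    rw [← ModuleCat.hom_comp, P.complex.d_comp_d, ModuleCat.hom_zero]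
  induction t, ht using Nat.le_induction generalizing M with
  | base =>
    obtain ⟨n, p, hp, hK⟩ := IsLocalRing.exists_surjective_ker_le_smul_top R M
    have hε : Function.Surjective (P.π.f 0).hom :=
      (ModuleCat.epi_iff_surjective (P.π.f 0)).mp inferInstance
    have hdε : Function.Exact (P.complex.d 1 0).hom (P.π.f 0).hom :=
      (ShortComplex.ShortExact.moduleCat_exact_iff_function_exact _).mp P.exact₀
    have hker : LinearMap.ker p = ⊥ := by
      refine IsLocalRing.eq_bot_of_rTensor_quotient_injective hfaith hK
        ((injective_iff_map_eq_zero _).mpr fun x hx => ?_)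
      obtain ⟨x, rfl⟩ := LinearMap.lTensor_surjective (LinearMap.ker p) hε x
      obtain ⟨y, hy⟩ := (lTensor_exact (Fin n → R) hdε hε
        ((LinearMap.ker p).subtype.rTensor _ x)).mp (by
          rw [← LinearMap.rTensor_lTensor_apply_comm]
          exact hx)
      obtain ⟨u, rfl⟩ := LinearMap.exists_lTensor_eq_of_rTensor_eq_lTensor
        p.exact_subtype_ker_map hp (hdd 0) ((torIsZero_succ_iff_exact P 0).mp h)
        (Module.Flat.rTensor_preserves_injective_linearMap _ (Submodule.subtype_injective _))
        hy.symm
      exact (lTensor_exact _ hdε hε).apply_apply_eq_zero u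
    have : Module.Projective R M :=
      .of_equiv (LinearEquiv.ofBijective p ⟨LinearMap.ker_eq_bot.mp hker, hp⟩)
    exact .of_projective
  | succ t ht ih =>
    obtain ⟨s, rfl⟩ := Nat.exists_eq_add_of_le' ht
    obtain ⟨n, p, hp⟩ := Module.Finite.exists_fin' R M
    refine .succ_of_exact (Submodule.subtype_injective _) p.exact_subtype_ker_map hp (ih ?_)
    rw [torIsZero_succ_iff_exact P]
    rw [torIsZero_succ_iff_exact P] at h
    have hex : Function.Exact (P.complex.d (s + 2) (s + 1)).hom (P.complex.d (s + 1) s).hom :=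
      (ShortComplex.ShortExact.moduleCat_exact_iff_function_exact _).mp (P.exact_succ s)
    intro x
    constructor
    · intro hx
      obtain ⟨y, hy⟩ := (Module.Flat.lTensor_exact (Fin n → R) hex
        ((LinearMap.ker p).subtype.rTensor _ x)).mp (by
          rw [← LinearMap.rTensor_lTensor_apply_comm, hx, map_zero])
      exact LinearMap.exists_lTensor_eq_of_rTensor_eq_lTensor
        p.exact_subtype_ker_map hp (hdd (s + 1)) h
        (Module.Flat.rTensor_preserves_injective_linearMap _ (Submodule.subtype_injective _))
        hy.symm
    · rintro ⟨y, rfl⟩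
      rw [← LinearMap.comp_apply, ← LinearMap.lTensor_comp, hdd, LinearMap.lTensor_zero,
        LinearMap.zero_apply]
end
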